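/- Let p > 3 be a prime. Then sum_{k=0}^{(p-3)/2} C((p-1)/2, 2k) * C(2k,k) * H_k^{(2)} / 4^k ≡ -E_{p-3}(1/4) (mod p), where the congruence is between rational numbers whose denominators are coprime to p. -/

import Mathlib

/-- The `n`-th Euler polynomial evaluated at `x`, via the standard closed form
`E_n(x) = ∑_{k=0}^n 2^{-k} ∑_{j=0}^k (-1)^j C(k,j) (x+j)^n`,
which agrees with the generating function definition `2e^{xt}/(e^t+1) = ∑ E_n(x) tⁿ/n!`. -/
def eulerE (n : ℕ) (x : ℚ) : ℚ :=
  ∑ k ∈ Finset.range (n + 1), (1 / 2 ^ k) *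
    ∑ j ∈ Finset.range (k + 1), (-1) ^ j * (k.choose j) * (x + j) ^ n

/-- `H2 n = ∑_{0 < k ≤ n} 1/k²`, the generalized harmonic number of order 2. -/
def H2 (n : ℕ) : ℚ := ∑ i ∈ Finset.range n, 1 / ((i : ℚ) + 1) ^ 2

/-- `ReducesTo p q a` says that the rational `q` is `p`-integral with residue `a` modulo `p`. -/
def ReducesTo (p : ℕ) (q : ℚ) (a : ZMod p) : Prop :=
  ∃ n d : ℤ, (d : ZMod p) ≠ 0 ∧ q * d = n ∧ a * d = n

namespace ReducesTo

variable {p : ℕ}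

theorem intCast [Fact p.Prime] (z : ℤ) : ReducesTo p z z :=
  ⟨z, 1, by simp, by simp, by simp⟩

theorem natCast [Fact p.Prime] (n : ℕ) : ReducesTo p n n := by
  simpa using intCast (p := p) n

theorem add [Fact p.Prime] {q r : ℚ} {a b : ZMod p} (h : ReducesTo p q a)
    (h' : ReducesTo p r b) : ReducesTo p (q + r) (a + b) := by
  obtain ⟨n, d, hd, hq, ha⟩ := h
  obtain ⟨n', d', hd', hr, hb⟩ := h'
  refine ⟨n * d' + n' * d, d * d', by push_cast; exact mul_ne_zero hd hd', ?_, ?_⟩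
  · push_cast
    linear_combination (d' : ℚ) * hq + (d : ℚ) * hr
  · push_cast
    linear_combination (d' : ZMod p) * ha + (d : ZMod p) * hb

theorem mul [Fact p.Prime] {q r : ℚ} {a b : ZMod p} (h : ReducesTo p q a)
    (h' : ReducesTo p r b) : ReducesTo p (q * r) (a * b) := by
  obtain ⟨n, d, hd, hq, ha⟩ := h
  obtain ⟨n', d', hd', hr, hb⟩ := h'
  refine ⟨n * n', d * d', by push_cast; exact mul_ne_zero hd hd', ?_, ?_⟩
  · push_cast
    rw [← hq, ← hr]
    ring
  · push_cast
    rw [← ha, ← hb]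
    ring

theorem neg {q : ℚ} {a : ZMod p} (h : ReducesTo p q a) : ReducesTo p (-q) (-a) := by
  obtain ⟨n, d, hd, hq, ha⟩ := h
  exact ⟨-n, d, hd, by push_cast; rw [← hq]; ring, by push_cast; rw [← ha]; ring⟩

theorem inv [Fact p.Prime] {q : ℚ} {a : ZMod p} (h : ReducesTo p q a) (ha0 : a ≠ 0) :
    ReducesTo p q⁻¹ a⁻¹ := by
  obtain ⟨n, d, hd, hq, ha⟩ := h
  have hn : (n : ZMod p) ≠ 0 := ha ▸ mul_ne_zero ha0 hd
  have hn' : (n : ℚ) ≠ 0 := by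
    rintro h0
    apply hn
    rw [Int.cast_eq_zero.mp h0, Int.cast_zero]
  have hq0 : q ≠ 0 := by
    rintro rfl
    simp [eq_comm] at hq
    exact hn' (by exact_mod_cast hq)
  refine ⟨d, n, hn, ?_, ?_⟩
  · rw [← hq]
    field_simp
  · rw [← ha]
    field_simp

theorem div [Fact p.Prime] {q r : ℚ} {a b : ZMod p} (h : ReducesTo p q a)
    (h' : ReducesTo p r b) (hb : b ≠ 0) : ReducesTo p (q / r) (a / b) := by
  rw [div_eq_mul_inv, div_eq_mul_inv]
  exact h.mul (h'.inv hb)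

theorem pow [Fact p.Prime] {q : ℚ} {a : ZMod p} (h : ReducesTo p q a) (n : ℕ) :
    ReducesTo p (q ^ n) (a ^ n) := by
  induction n with
  | zero => simpa using natCast (p := p) 1
  | succ n ih => simpa only [pow_succ] using ih.mul h

theorem sum_range [Fact p.Prime] {f : ℕ → ℚ} {g : ℕ → ZMod p} {n : ℕ}
    (h : ∀ k < n, ReducesTo p (f k) (g k)) :
    ReducesTo p (∑ k ∈ Finset.range n, f k) (∑ k ∈ Finset.range n, g k) := by
  induction n with
  | zero => simpa using natCast (p := p) 0
  | succ n ih =>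
    rw [Finset.sum_range_succ, Finset.sum_range_succ]
    exact (ih fun k hk => h k (by omega)).add (h n (by omega))

theorem dvd_num [Fact p.Prime] {q : ℚ} (h : ReducesTo p q 0) : (p : ℤ) ∣ q.num := by
  obtain ⟨n, d, hd, hq, ha⟩ := h
  rw [zero_mul, eq_comm, ZMod.intCast_zmod_eq_zero_iff_dvd] at ha
  rw [Ne, ZMod.intCast_zmod_eq_zero_iff_dvd] at hd
  have key : q.num * d = n * q.den := by
    have : (q.num : ℚ) = q * q.den := (Rat.mul_den_eq_num q).symm
    have : (q.num : ℚ) * d = n * q.den := by rw [this, ← hq]; ring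
    exact_mod_cast this
  have hp : Prime (p : ℤ) := Nat.prime_iff_prime_int.mp Fact.out
  exact (hp.dvd_or_dvd (key ▸ ha.mul_right _ : (p : ℤ) ∣ q.num * d)).resolve_right hd

end ReducesTo

section Field

variable {F : Type*} [Field F]

/-- The alternating binomial sum `∑ (-1)^j C(k,j) (x+j)^n`, i.e. `(-1)^k` times the `k`-th forward
difference of the `n`-th power. -/
def altDiffPow (n k : ℕ) (x : F) : F :=
  ∑ j ∈ Finset.range (k + 1), (-1) ^ j * (k.choose j : F) * (x + j) ^ n

/-- The Euler polynomial evaluated in a field. -/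
def eulerField (n : ℕ) (x : F) : F :=
  ∑ k ∈ Finset.range (n + 1), (1 / 2 ^ k) * altDiffPow n k x

/-- The second order harmonic numbers in a field. -/
def harmonicSq (F : Type*) [Field F] (n : ℕ) : F :=
  ∑ i ∈ Finset.range n, 1 / ((i : F) + 1) ^ 2

theorem altDiffPow_eq_fwdDiff (n k : ℕ) (x : F) :
    altDiffPow n k x = (-1) ^ k * (fwdDiff 1)^[k] (fun y : F => y ^ n) x := by
  rw [fwdDiff_iter_eq_sum_shift, altDiffPow, Finset.mul_sum]
  refine Finset.sum_congr rfl fun j hj => ?_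
  have hj : j ≤ k := by simpa [Nat.lt_succ_iff] using hj
  obtain ⟨i, rfl⟩ := Nat.exists_eq_add_of_le hj
  have h : ((-1 : F)) ^ (j + i) * (-1) ^ i = (-1) ^ j := by
    rw [pow_add, mul_assoc, ← mul_pow]
    simp
  simp only [zsmul_eq_mul, Nat.add_sub_cancel_left, nsmul_eq_mul, mul_one]
  push_cast
  rw [← mul_assoc, ← mul_assoc, h]

theorem altDiffPow_succ (n k : ℕ) (x : F) :
    altDiffPow n (k + 1) x = altDiffPow n k x - altDiffPow n k (x + 1) := by
  simp only [altDiffPow_eq_fwdDiff, Function.iterate_succ', Function.comp_apply, fwdDiff]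
  ring

theorem altDiffPow_self_succ (n : ℕ) (x : F) : altDiffPow n (n + 1) x = 0 := by
  rw [altDiffPow_eq_fwdDiff, fwdDiff_iter_pow_eq_zero_of_lt (Nat.lt_succ_self n)]
  simp

theorem eulerField_add_eulerField_add_one (h2 : (2 : F) ≠ 0) (n : ℕ) (x : F) :
    eulerField n x + eulerField n (x + 1) = 2 * x ^ n := by
  have key (N : ℕ) : ∑ k ∈ Finset.range N, (1 / 2 ^ k) * altDiffPow n k x +
      ∑ k ∈ Finset.range N, (1 / 2 ^ k) * altDiffPow n k (x + 1) =
      2 * x ^ n - 2 / 2 ^ N * altDiffPow n N x := by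
    induction N with
    | zero => simp [altDiffPow]
    | succ N ih =>
      rw [Finset.sum_range_succ, Finset.sum_range_succ, add_add_add_comm, ih, altDiffPow_succ]
      field_simp
      ring
  have := key (n + 1)
  rwa [altDiffPow_self_succ, mul_zero, sub_zero] at this

theorem cast_choose_succ_mul (n k : ℕ) :
    (n.choose (k + 1) : F) * (k + 1) = n.choose k * (n - k) := by
  rcases le_or_gt k n with h | h
  · have := congrArg (Nat.cast (R := F)) (Nat.choose_succ_right_eq n k)
    push_cast [Nat.cast_sub h] at this
    exact this
  · simp [Nat.choose_eq_zero_of_lt h, Nat.choose_eq_zero_of_lt (Nat.lt_succ_of_lt h)]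

theorem cast_choose_add_succ_mul (m k : ℕ) :
    ((m + (k + 1)).choose (k + 1) : F) * (k + 1) = (m + k + 1) * (m + k).choose k := by
  have := congrArg (Nat.cast (R := F)) (Nat.add_one_mul_choose_eq (m + k) k)
  push_cast at this
  rw [← add_assoc]
  exact this.symm

theorem cast_succ_mul_choose (m k : ℕ) :
    ((m : F) + 1) * m.choose k = (m + 1 - k) * (m + 1).choose k := by
  rcases le_or_gt k (m + 1) with h | h
  · have := congrArg (Nat.cast (R := F)) (Nat.choose_mul_succ_eq m k)
    push_cast [Nat.cast_sub h] at this
    linear_combination this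
  · simp [Nat.choose_eq_zero_of_lt h, Nat.choose_eq_zero_of_lt (show m < k by omega)]

theorem cast_succ_mul_choose_add (m k : ℕ) :
    ((m : F) + 1) * (m + 1 + k).choose k = (m + 1 + k) * (m + k).choose k := by
  have := congrArg (Nat.cast (R := F)) (Nat.choose_mul_succ_eq (m + k) k)
  rw [show m + k + 1 - k = m + 1 by omega, show m + k + 1 = m + 1 + k by omega] at this
  push_cast at this
  linear_combination -this

/-- The coefficients `(-1)^k C(m,k) C(m+k,k)` of the shifted Legendre polynomials. -/
def legendreCoeff (F : Type*) [Field F] (m k : ℕ) : F :=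
  (-1) ^ k * m.choose k * (m + k).choose k

theorem legendreCoeff_succ (m k : ℕ) :
    ((k : F) + 1) ^ 2 * legendreCoeff F m (k + 1) =
      -((m - k) * (m + k + 1)) * legendreCoeff F m k := by
  simp only [legendreCoeff]
  have h1 := cast_choose_succ_mul (F := F) m k
  have h2 := cast_choose_add_succ_mul (F := F) m k
  linear_combination (-1 : F) ^ (k + 1) * ((m + (k + 1)).choose (k + 1) * (k + 1)) * h1 +
    (-1 : F) ^ (k + 1) * (m.choose k * (m - k)) * h2

theorem choose_two_mul_succ (n k : ℕ) :
    ((k : F) + 1) ^ 2 * ((n.choose (2 * (k + 1)) : F) * (2 * (k + 1)).choose (k + 1)) =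
      (n - 2 * k) * (n - 2 * k - 1) * (n.choose (2 * k) * (2 * k).choose k) := by
  have h1 := cast_choose_succ_mul (F := F) n (2 * k)
  have h2 := cast_choose_succ_mul (F := F) n (2 * k + 1)
  have h3 := congrArg (Nat.cast (R := F)) (Nat.succ_mul_centralBinom_succ k)
  simp only [Nat.centralBinom] at h3
  push_cast at h1 h2 h3
  rw [show 2 * (k + 1) = 2 * k + 1 + 1 by omega] at h3 ⊢
  linear_combination ((k : F) + 1) * n.choose (2 * k + 1 + 1) * h3 +
    ((2 * k : F) + 1) * (2 * k).choose k * h2 +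
    (2 * k).choose k * ((n : F) - (2 * k + 1)) * h1

/-- If `n = -1/2` and `m = -3/4` in `F`, the summands of the two binomial sums agree. -/
theorem choose_mul_choose_div_eq_legendreCoeff (h2 : (2 : F) ≠ 0) {n m : ℕ}
    (hn : 2 * (n : F) = -1) (hm : 4 * (m : F) = -3) (k : ℕ)
    (hk : ∀ i : ℕ, i < k → (i : F) + 1 ≠ 0) :
    (n.choose (2 * k) : F) * (2 * k).choose k / 4 ^ k = legendreCoeff F m k := by
  induction k with
  | zero => simp [legendreCoeff]
  | succ k ih =>
    have ih := ih fun i hi => hk i (by omega)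
    have hk1 := hk k (by omega)
    have h4 : (4 : F) ≠ 0 := by
      rw [show (4 : F) = 2 * 2 by norm_num]
      exact mul_ne_zero h2 h2
    have hA := choose_two_mul_succ (F := F) n k
    have hB := legendreCoeff_succ (F := F) m k
    rw [← ih] at hB
    apply mul_left_cancel₀ (mul_ne_zero (pow_ne_zero 2 h4) (pow_ne_zero 2 hk1))
    have hC : (4 : F) ^ 2 * (-((m - k) * (m + k + 1))) =
        4 * ((n - 2 * k) * (n - 2 * k - 1)) := by
      linear_combination (-(4 * (m : F)) - 1) * hm - (2 * (n : F) - 8 * k - 3) * hn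
    rw [mul_assoc _ _ (legendreCoeff F m (k + 1)), hB,
      ← mul_assoc _ (-(((m : F) - k) * (m + k + 1))), hC, pow_succ 4 k]
    field_simp
    linear_combination hA

/-- The discrete antiderivative used to sum consecutive Legendre coefficients. -/
def legendreMid (F : Type*) [Field F] (m k : ℕ) : F :=
  (-1) ^ k * (m + 1).choose k * (m + k).choose k

theorem legendreCoeff_add_legendreCoeff_succ {m : ℕ} (hm : (m : F) + 1 ≠ 0) (k : ℕ) :
    legendreCoeff F m k + legendreCoeff F (m + 1) k = 2 * legendreMid F m k := by
  apply mul_left_cancel₀ hm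
  simp only [legendreCoeff, legendreMid]
  linear_combination (-1 : F) ^ k * (m + k).choose k * cast_succ_mul_choose (F := F) m k +
    (-1 : F) ^ k * (m + 1).choose k * cast_succ_mul_choose_add (F := F) m k

theorem sq_mul_legendreMid_sub (m k : ℕ) :
    ((k + 1 : ℕ) : F) ^ 2 * legendreMid F m (k + 1) - (k : F) ^ 2 * legendreMid F m k =
      -((m : F) + 1) ^ 2 * legendreMid F m k := by
  simp only [legendreMid]
  have h1 := cast_choose_succ_mul (F := F) (m + 1) k
  have h2 := cast_choose_add_succ_mul (F := F) m k
  push_cast at h1 ⊢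
  linear_combination (-1 : F) ^ (k + 1) * ((m + (k + 1)).choose (k + 1) * (k + 1)) * h1 +
    (-1 : F) ^ (k + 1) * ((m + 1).choose k * (m + 1 - k)) * h2

theorem sum_legendreMid {m N : ℕ} (hm : (m : F) + 1 ≠ 0) (hN : m + 1 ≤ N) :
    ∑ k ∈ Finset.range (N + 1), legendreMid F m k = 0 := by
  have h := Finset.sum_range_sub (fun k : ℕ => (k : F) ^ 2 * legendreMid F m k) (N + 1)
  simp only [sq_mul_legendreMid_sub] at h
  rw [← Finset.mul_sum] at h
  have h0 : legendreMid F m (N + 1) = 0 := by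
    simp [legendreMid, Nat.choose_eq_zero_of_lt (show m + 1 < N + 1 by omega)]
  rw [h0] at h
  simpa [hm] using h

theorem sum_legendreMid_mul_harmonicSq_aux (m N : ℕ) (hN : ∀ i : ℕ, i < N → (i : F) + 1 ≠ 0) :
    -((m : F) + 1) ^ 2 * ∑ k ∈ Finset.range N, legendreMid F m k * harmonicSq F k =
      (N : F) ^ 2 * legendreMid F m N * harmonicSq F N -
        ∑ k ∈ Finset.range N, legendreMid F m (k + 1) := by
  induction N with
  | zero => simp
  | succ N ih =>
    have ih := ih fun i hi => hN i (by omega)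
    have hN1 := hN N (by omega)
    have hs := sq_mul_legendreMid_sub (F := F) m N
    have hh : harmonicSq F (N + 1) = harmonicSq F N + 1 / ((N : F) + 1) ^ 2 := by
      rw [harmonicSq, Finset.sum_range_succ, harmonicSq]
    have hc : ((N + 1 : ℕ) : F) ^ 2 * (1 / ((N : F) + 1) ^ 2) = 1 := by
      push_cast
      field_simp
    rw [Finset.sum_range_succ, Finset.sum_range_succ, hh]
    linear_combination ih - harmonicSq F N * hs - legendreMid F m (N + 1) * hc

theorem sum_legendreMid_mul_harmonicSq {m N : ℕ} (hN : ∀ i : ℕ, i < N → (i : F) + 1 ≠ 0)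
    (hm : m + 1 ≤ N) :
    ((m : F) + 1) ^ 2 * ∑ k ∈ Finset.range (N + 1), legendreMid F m k * harmonicSq F k = -1 := by
  have h := sum_legendreMid_mul_harmonicSq_aux m N hN
  have h0 := sum_legendreMid (hN m hm) hm
  have hs := sq_mul_legendreMid_sub (F := F) m N
  have hz : legendreMid F m (N + 1) = 0 := by
    simp [legendreMid, Nat.choose_eq_zero_of_lt (show m + 1 < N + 1 by omega)]
  rw [Finset.sum_range_succ'] at h0
  have h1 : legendreMid F m 0 = 1 := by simp [legendreMid]
  rw [hz] at hs
  rw [h1] at h0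
  rw [Finset.sum_range_succ]
  linear_combination -h + harmonicSq F N * hs + h0

theorem sum_legendreCoeff_add_succ {m N : ℕ} (hN : ∀ i : ℕ, i < N → (i : F) + 1 ≠ 0)
    (hm : m + 1 ≤ N) :
    ∑ k ∈ Finset.range (N + 1), legendreCoeff F m k * harmonicSq F k +
      ∑ k ∈ Finset.range (N + 1), legendreCoeff F (m + 1) k * harmonicSq F k =
      -2 / ((m : F) + 1) ^ 2 := by
  have hm0 := hN m hm
  rw [← Finset.sum_add_distrib, eq_div_iff (pow_ne_zero 2 hm0)]
  simp only [← add_mul, legendreCoeff_add_legendreCoeff_succ hm0, mul_assoc]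
  rw [← Finset.mul_sum]
  linear_combination 2 * sum_legendreMid_mul_harmonicSq hN hm

end Field

section ZMod

variable {p : ℕ} [Fact p.Prime]

theorem ZMod.natCast_add_one_ne_zero {i : ℕ} (hi : i + 1 < p) : (i : ZMod p) + 1 ≠ 0 := by
  intro h
  have h' : ((i + 1 : ℕ) : ZMod p) = 0 := by exact_mod_cast h
  rw [ZMod.natCast_eq_zero_iff] at h'
  exact absurd (Nat.le_of_dvd (by omega) h') (by omega)

theorem ZMod.two_ne_zero_of_three_lt (hp3 : 3 < p) : (2 : ZMod p) ≠ 0 := by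
  have := ZMod.natCast_add_one_ne_zero (p := p) (i := 1) (by omega)
  norm_num at this
  exact this

theorem eulerField_zero (hp3 : 3 < p) : eulerField (p - 3) (0 : ZMod p) = 0 := by
  have h2 := ZMod.two_ne_zero_of_three_lt hp3
  have hodd : Odd p := (Fact.out : p.Prime).odd_of_ne_two (by omega)
  have heven : Even (p - 3) := by
    obtain ⟨r, rfl⟩ := hodd
    exact ⟨r - 1, by omega⟩
  have hE := eulerField_add_eulerField_add_one (F := ZMod p) h2 (p - 3)
  have hg (j : ℕ) : eulerField (p - 3) (j : ZMod p) - eulerField (p - 3) (1 - (j : ZMod p)) =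
      (-1) ^ j * (eulerField (p - 3) (0 : ZMod p) - eulerField (p - 3) 1) := by
    induction j with
    | zero => simp
    | succ j ih =>
      have h1 := hE j
      have h3 := hE (-(j : ZMod p))
      rw [heven.neg_pow, neg_add_eq_sub] at h3
      push_cast
      rw [show (1 : ZMod p) - (j + 1) = -j by ring, pow_succ]
      linear_combination -ih + h1 - h3
  have h := hg p
  have h0 := hE 0
  rw [CharP.cast_eq_zero, sub_zero, hodd.neg_one_pow] at h
  rw [zero_pow (by omega), zero_add] at h0
  apply mul_left_cancel₀ (mul_ne_zero h2 h2)
  linear_combination h + 2 * h0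

theorem sum_legendreCoeff_mul_harmonicSq (hp3 : 3 < p) {m : ℕ} (hm : m < p) :
    ∑ k ∈ Finset.range p, legendreCoeff (ZMod p) m k * harmonicSq (ZMod p) k =
      -eulerField (p - 3) ((m : ZMod p) + 1) := by
  have h2 := ZMod.two_ne_zero_of_three_lt hp3
  have hE := eulerField_add_eulerField_add_one (F := ZMod p) h2 (p - 3)
  induction m with
  | zero =>
    have h0 := hE 0
    rw [zero_pow (by omega), eulerField_zero hp3, zero_add, zero_add] at h0
    rw [Nat.cast_zero, zero_add, h0, mul_zero, neg_zero]
    refine Finset.sum_eq_zero fun k _ => ?_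
    rcases k with _ | k <;> simp [legendreCoeff, harmonicSq]
  | succ m ih =>
    have ih := ih (by omega)
    have hN : ∀ i : ℕ, i < p - 1 → (i : ZMod p) + 1 ≠ 0 := fun i hi =>
      ZMod.natCast_add_one_ne_zero (by omega)
    have h := sum_legendreCoeff_add_succ (m := m) hN (by omega)
    rw [Nat.sub_add_cancel (by omega : 1 ≤ p)] at h
    have hm0 := hN m (by omega)
    have hpow : ((m : ZMod p) + 1) ^ (p - 3) = 1 / ((m : ZMod p) + 1) ^ 2 := by
      rw [eq_div_iff (pow_ne_zero 2 hm0), ← pow_add, show p - 3 + 2 = p - 1 by omega]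
      exact ZMod.pow_card_sub_one_eq_one hm0
    have h3 := hE ((m : ZMod p) + 1)
    rw [hpow] at h3
    push_cast
    linear_combination h - ih + h3

theorem reducesTo_H2 {k : ℕ} (hk : k < p) : ReducesTo p (H2 k) (harmonicSq (ZMod p) k) := by
  refine ReducesTo.sum_range fun i hi => ?_
  have h1 : ReducesTo p 1 1 := by simpa using ReducesTo.natCast (p := p) 1
  exact h1.div (((ReducesTo.natCast i).add h1).pow 2)
    (pow_ne_zero 2 (ZMod.natCast_add_one_ne_zero (by omega)))

theorem reducesTo_eulerE (h2 : (2 : ZMod p) ≠ 0) (n : ℕ) {x : ℚ} {a : ZMod p}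
    (hx : ReducesTo p x a) : ReducesTo p (eulerE n x) (eulerField n a) := by
  have h1 : ReducesTo p 1 1 := by simpa using ReducesTo.natCast (p := p) 1
  have h2' : ReducesTo p 2 2 := by simpa using ReducesTo.natCast (p := p) 2
  exact ReducesTo.sum_range fun k _ => (h1.div (h2'.pow k) (pow_ne_zero k h2)).mul <|
    ReducesTo.sum_range fun j _ =>
      ((h1.neg.pow j).mul (ReducesTo.natCast _)).mul ((hx.add (ReducesTo.natCast j)).pow n)

end ZMod

/-- Lemma 2.6, first congruence (Mao): for any prime `p > 3`,
`∑_{k=0}^{(p-3)/2} C((p-1)/2,2k) C(2k,k) H_k⁽²⁾ / 4^k ≡ -E_{p-3}(1/4) (mod p)`. -/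
theorem sum_choose_H2_congr_eulerE (p : ℕ) (hp : p.Prime) (hp3 : 3 < p) :
    ((p : ℤ)) ∣
      ((∑ k ∈ Finset.range ((p - 3) / 2 + 1),
          (((p - 1) / 2).choose (2 * k) : ℚ) * ((2 * k).choose k : ℚ) * H2 k / 4 ^ k) -
        (-eulerE (p - 3) (1 / 4))).num := by
  have : Fact p.Prime := ⟨hp⟩
  have h2 := ZMod.two_ne_zero_of_three_lt hp3
  have h4 : (4 : ZMod p) ≠ 0 := by
    rw [show (4 : ZMod p) = 2 * 2 by norm_num]
    exact mul_ne_zero h2 h2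
  have h1' : ReducesTo p 1 1 := by simpa using ReducesTo.natCast (p := p) 1
  have h4' : ReducesTo p 4 4 := by simpa using ReducesTo.natCast (p := p) 4
  obtain ⟨r, hr⟩ := hp.odd_of_ne_two (by omega)
  set n := (p - 1) / 2 with hn
  set m := (-3 / 4 : ZMod p).val with hm
  have hmc : (m : ZMod p) = -3 / 4 := ZMod.natCast_zmod_val _
  have hnc : 2 * (n : ZMod p) = -1 := by
    have h : 2 * n + 1 = p := by omega
    have h' := congrArg (Nat.cast (R := ZMod p)) h
    push_cast at h'
    rw [CharP.cast_eq_zero (ZMod p) p] at h'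
    linear_combination h'
  have hsum : ∑ k ∈ Finset.range ((p - 3) / 2 + 1),
      (n.choose (2 * k) : ZMod p) * ((2 * k).choose k : ZMod p) * harmonicSq (ZMod p) k / 4 ^ k =
      -eulerField (p - 3) (1 / 4) := by
    have hE := sum_legendreCoeff_mul_harmonicSq hp3 (ZMod.val_lt (-3 / 4 : ZMod p))
    rw [← hm, hmc, show (-3 / 4 + 1 : ZMod p) = 1 / 4 by field_simp; norm_num] at hE
    rw [← hE]
    have hterm (k : ℕ) (hk : k < p) :
        (n.choose (2 * k) : ZMod p) * ((2 * k).choose k : ZMod p) * harmonicSq (ZMod p) k / 4 ^ k =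
        legendreCoeff (ZMod p) m k * harmonicSq (ZMod p) k := by
      rw [← choose_mul_choose_div_eq_legendreCoeff h2 hnc (by rw [hmc]; field_simp) k
        fun i hi => ZMod.natCast_add_one_ne_zero (by omega)]
      ring
    rw [← Finset.sum_congr rfl fun k hk => hterm k (Finset.mem_range.mp hk)]
    refine Finset.sum_subset (Finset.range_subset_range.mpr (by omega)) fun k _ hk => ?_
    rw [Finset.mem_range] at hk
    simp [Nat.choose_eq_zero_of_lt (show n < 2 * k by omega)]
  apply ReducesTo.dvd_num
  rw [← sub_self (-eulerField (p - 3) (1 / 4 : ZMod p)), sub_eq_add_neg, sub_eq_add_neg]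
  refine ReducesTo.add ?_ (reducesTo_eulerE h2 _ (h1'.div h4' h4)).neg.neg
  rw [← hsum]
  exact ReducesTo.sum_range fun k hk =>
    (((ReducesTo.natCast _).mul (ReducesTo.natCast _)).mul (reducesTo_H2 (by omega))).div
      (h4'.pow k) (pow_ne_zero k h4)
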